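/- Fix q ∈ (0,1) and integers N, k ≥ 0. The function F(τ) = τ^{N+1}(1−τ²)(q^{2k+2}τ²;q²)_∞ / ((1−qτ)² ((q^{2k+1}τ;q²)_∞)²) is differentiable at τ = q, and F'(q) = ( q^N (N+1)(1−q^{2k+2}) + 2 q^{N+2k+2} ) / ( (1−q²)(1−q^{2k+2})² (q^{2k+2};q²)_∞ ). -/

import Mathlib

open scoped BigOperators

noncomputable section

/-- The infinite q-Pochhammer symbol `(a;Q)_∞ = ∏_{j=0}^{∞} (1 − a Q^j)`. -/
noncomputable def qPochInf (a Q : ℂ) : ℂ := ∏' j : ℕ, (1 - a * Q ^ j)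

theorem summable_norm_mul_pow (a : ℂ) {Q : ℂ} (hQ : ‖Q‖ < 1) :
    Summable fun j : ℕ ↦ ‖-(a * Q ^ j)‖ := by
  simpa using (summable_geometric_of_lt_one (norm_nonneg _) hQ).mul_left ‖a‖

theorem multipliable_qPochInf (a : ℂ) {Q : ℂ} (hQ : ‖Q‖ < 1) :
    Multipliable fun j : ℕ ↦ 1 - a * Q ^ j := by
  simpa only [sub_eq_add_neg] using
    multipliable_one_add_of_summable (summable_norm_mul_pow a hQ)

theorem qPochInf_eq_mul (a : ℂ) {Q : ℂ} (hQ : ‖Q‖ < 1) :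
    qPochInf a Q = (1 - a) * qPochInf (a * Q) Q := by
  have h : Multipliable fun j : ℕ ↦ 1 - a * Q ^ (j + 1) := by
    simpa only [pow_succ', mul_assoc] using multipliable_qPochInf (a * Q) hQ
  simpa [qPochInf, pow_succ', mul_assoc] using
    tprod_eq_zero_mul' (f := fun j : ℕ ↦ 1 - a * Q ^ j) h

theorem qPochInf_ne_zero {a Q : ℂ} (hQ : ‖Q‖ < 1) (ha : ‖a‖ < 1) : qPochInf a Q ≠ 0 := by
  simp only [qPochInf, sub_eq_add_neg]
  refine tprod_one_add_ne_zero_of_summable (fun j h ↦ ?_) (summable_norm_mul_pow a hQ)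
  have h1 : a * Q ^ j = 1 := by linear_combination -h
  have h2 : ‖a * Q ^ j‖ < 1 := by
    rw [norm_mul, norm_pow]
    exact (mul_le_of_le_one_right (norm_nonneg _)
      (pow_le_one₀ (norm_nonneg _) hQ.le)).trans_lt ha
  simp [h1] at h2

theorem differentiable_qPochInf {Q : ℂ} (hQ : ‖Q‖ < 1) :
    Differentiable ℂ fun a ↦ qPochInf a Q := by
  intro a
  have hu : Summable fun j : ℕ ↦ (‖a‖ + 1) * ‖Q‖ ^ j :=
    (summable_geometric_of_lt_one (norm_nonneg _) hQ).mul_left _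
  have hprod := hu.hasProdLocallyUniformlyOn_nat_one_add (f := fun j x ↦ -(x * Q ^ j))
    (Metric.isOpen_ball (x := (0 : ℂ)) (ε := ‖a‖ + 1))
    (.of_forall fun j x hx ↦ by
      rw [norm_neg, norm_mul, norm_pow]
      gcongr
      exact (mem_ball_zero_iff.mp hx).le)
    (fun j ↦ by fun_prop)
  have hdiff := hprod.differentiableOn
    (.of_forall fun _ ↦ by simpa [Finset.prod_fn] using
      DifferentiableOn.finsetProd (fun _ _ ↦ by fun_prop)) Metric.isOpen_ball
  simp only [← sub_eq_add_neg] at hdiff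
  exact hdiff.differentiableAt (Metric.isOpen_ball.mem_nhds (by simp))

theorem hasDerivAt_qPochInf_of_mul {a Q d : ℂ} (hQ : ‖Q‖ < 1)
    (hd : HasDerivAt (fun x ↦ qPochInf x Q) d (a * Q)) :
    HasDerivAt (fun x ↦ qPochInf x Q) (-qPochInf (a * Q) Q + (1 - a) * (d * Q)) a := by
  have hlin : HasDerivAt (fun x : ℂ ↦ x * Q) Q a := by
    simpa using (hasDerivAt_id a).mul_const Q
  have hmul := ((hasDerivAt_id a).const_sub 1).mul (hd.comp a hlin)
  rw [funext fun x ↦ qPochInf_eq_mul x hQ]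
  exact hmul.congr_deriv (by simp)

/-- the residue computation at the double pole `τ = q`: the function
`F(τ) = τ^{N+1}(1−τ²)(q^{2k+2}τ²;q²)_∞ / ((1−qτ)² ((q^{2k+1}τ;q²)_∞)²)` is differentiable
at `τ = q` with
`F'(q) = (q^N (N+1)(1−q^{2k+2}) + 2 q^{N+2k+2}) / ((1−q²)(1−q^{2k+2})² (q^{2k+2};q²)_∞)`. -/
theorem residue_derivative_formula (q : ℝ) (hq : q ∈ Set.Ioo (0 : ℝ) 1) (N k : ℕ) :
    HasDerivAt
      (fun τ : ℂ =>
        τ ^ (N + 1) * (1 - τ ^ 2) * qPochInf ((q : ℂ) ^ (2 * k + 2) * τ ^ 2) ((q : ℂ) ^ 2) /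
          ((1 - (q : ℂ) * τ) ^ 2 * (qPochInf ((q : ℂ) ^ (2 * k + 1) * τ) ((q : ℂ) ^ 2)) ^ 2))
      (((q : ℂ) ^ N * ((N : ℂ) + 1) * (1 - (q : ℂ) ^ (2 * k + 2)) + 2 * (q : ℂ) ^ (N + 2 * k + 2)) /
        ((1 - (q : ℂ) ^ 2) * (1 - (q : ℂ) ^ (2 * k + 2)) ^ 2 *
          qPochInf ((q : ℂ) ^ (2 * k + 2)) ((q : ℂ) ^ 2)))
      (q : ℂ) := by
  obtain ⟨hq0, hq1⟩ := hq
  have hqn : ‖(q : ℂ)‖ < 1 := by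
    rwa [Complex.norm_real, Real.norm_of_nonneg hq0.le]
  have hpow (n : ℕ) : ‖(q : ℂ) ^ (n + 1)‖ < 1 := by
    rw [norm_pow]
    exact pow_lt_one₀ (norm_nonneg _) hqn n.succ_ne_zero
  have hsub (n : ℕ) : 1 - (q : ℂ) ^ (n + 1) ≠ 0 := fun h ↦ by
    have := hpow n
    rw [← sub_eq_zero.mp h, norm_one] at this
    exact this.false
  have hQ : ‖(q : ℂ) ^ 2‖ < 1 := hpow 1
  have hQ1 : 1 - (q : ℂ) ^ 2 ≠ 0 := hsub 1
  have ha1 : 1 - (q : ℂ) ^ (2 * k + 2) ≠ 0 := hsub (2 * k + 1)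
  have hP : qPochInf ((q : ℂ) ^ (2 * k + 2)) ((q : ℂ) ^ 2) ≠ 0 :=
    qPochInf_ne_zero hQ (hpow (2 * k + 1))
  have hfun := qPochInf_eq_mul ((q : ℂ) ^ (2 * k + 2)) hQ
  have hd := (differentiable_qPochInf hQ ((q : ℂ) ^ (2 * k + 2) * (q : ℂ) ^ 2)).hasDerivAt
  have hd' := hasDerivAt_qPochInf_of_mul hQ hd
  have hNpow : (q : ℂ) ^ (N + 2 * k + 2) = (q : ℂ) ^ N * (q : ℂ) ^ (2 * k + 1) * q := by ring
  have hcq : (q : ℂ) ^ (2 * k + 2) = (q : ℂ) ^ (2 * k + 1) * q := by ring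
  rw [hNpow]
  rw [hcq] at ha1 hP hfun hd hd' ⊢
  clear hNpow hcq
  generalize (q : ℂ) ^ (2 * k + 1) = c at *
  generalize (q : ℂ) = z at *
  generalize deriv (fun a ↦ qPochInf a (z ^ 2)) (c * z * z ^ 2) = d at *
  have hnum : HasDerivAt (fun τ : ℂ ↦ qPochInf (c * z * τ ^ 2) (z ^ 2))
      (d * (c * z * (2 * z))) z :=
    HasDerivAt.comp (h := fun τ ↦ c * z * τ ^ 2) z hd
      (by simpa using (hasDerivAt_pow 2 z).const_mul (c * z))
  have hden : HasDerivAt (fun τ : ℂ ↦ qPochInf (c * τ) (z ^ 2))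
      ((-qPochInf (c * z * z ^ 2) (z ^ 2) + (1 - c * z) * (d * z ^ 2)) * c) z :=
    hd'.comp z (by simpa using (hasDerivAt_id z).const_mul c)
  have hpoly := (hasDerivAt_pow (N + 1) z).mul ((hasDerivAt_pow 2 z).const_sub 1)
  have hlin : HasDerivAt (fun τ : ℂ ↦ 1 - z * τ) (-z) z := by
    simpa using ((hasDerivAt_id z).const_mul z).const_sub 1
  have hzz : 1 - z * z ≠ 0 := by rwa [← sq]
  have hmain := (hpoly.mul hnum).div ((hlin.pow 2).mul (hden.pow 2))
    (mul_ne_zero (pow_ne_zero 2 hzz) (pow_ne_zero 2 hP))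
  refine hmain.congr_deriv ?_
  have hB : qPochInf (c * z * z ^ 2) (z ^ 2) ≠ 0 := right_ne_zero_of_mul (hfun ▸ hP)
  simp only [Pi.mul_apply, Pi.pow_apply, hfun]
  generalize qPochInf (c * z * z ^ 2) (z ^ 2) = B at *
  push_cast
  simp only [← sq]
  field_simp
  ring

end
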